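/- (Projection Lemma) Fix a threshold-weighted graph (G,θ), a positive integer n, a join-tree A over G, and a set S ⊆ V(G). For every relation 𝒜 ⊆ [n]^{A|S} and every sub-join-tree B ⪯ A, χ_{B|S}(proj_{B|S}(𝒜)) ≤ χ_{A|S}(𝒜). -/

import Mathlib

open scoped Classical

noncomputable section

namespace Paper

/-- A join-tree: a finite rooted binary tree whose leaves are labeled by
edges (elements of `Sym2 α`) or by `⊥` (here `none`). -/
inductive JoinTree (α : Type*) where
  | leaf : Option (Sym2 α) → JoinTree α
  | node : JoinTree α → JoinTree α → JoinTree α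

variable {V : Type*}

/-- The vertex set of a finite edge set (a finite subgraph given by its edges). -/
def vset (F : Finset (Sym2 V)) : Set V := {v | ∃ e ∈ F, v ∈ e}

lemma vset_mono {F F' : Finset (Sym2 V)} (h : F ⊆ F') : vset F ⊆ vset F' := by
  rintro v ⟨e, he, hv⟩
  exact ⟨e, h he, hv⟩

/-- `Δ_θ(F) = |V(F)| − Σ_{e ∈ E(F)} θ(e)`. -/
def Delta (θ : Sym2 V → ℝ) (F : Finset (Sym2 V)) : ℝ :=
  ((vset F).ncard : ℝ) - ∑ e ∈ F, θ e

/-- `θ` is a threshold weighting on the graph with edge set `E`: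
it takes values in `[0,2]` on `E`, `Δ_θ(F) ≥ 0` for every finite subgraph `F ⊆ E`,
and `Δ_θ(E) = 0` whenever `E` is finite. -/
def IsThresholdWeighting (E : Set (Sym2 V)) (θ : Sym2 V → ℝ) : Prop :=
  (∀ e ∈ E, 0 ≤ θ e ∧ θ e ≤ 2) ∧
  (∀ F : Finset (Sym2 V), (F : Set (Sym2 V)) ⊆ E → 0 ≤ Delta θ F) ∧
  (∀ hE : E.Finite, Delta θ hE.toFinset = 0)

/-- `F ⊖ S`: the union of the connected components of `F` that are vertex-disjoint
from `S`. -/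
def elimS (F : Finset (Sym2 V)) (S : Set V) : Finset (Sym2 V) :=
  F.filter fun e =>
    ∀ v ∈ e, ∀ s ∈ S, ¬ (SimpleGraph.fromEdgeSet (F : Set (Sym2 V))).Reachable v s

/-- The graph with edge set `F` is connected. -/
def ConnE (F : Finset (Sym2 V)) : Prop :=
  ∀ u ∈ vset F, ∀ w ∈ vset F, (SimpleGraph.fromEdgeSet (F : Set (Sym2 V))).Reachable u w

/-- The subgraph of `F` induced on a vertex set `T`. -/
def induced (F : Finset (Sym2 V)) (T : Set V) : Finset (Sym2 V) :=
  F.filter fun e => ∀ v ∈ e, v ∈ T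

namespace JoinTree

/-- The graph of a join-tree: the finite subgraph whose edges are the labels
occurring in the tree. -/
def graph : JoinTree V → Finset (Sym2 V)
  | leaf none => ∅
  | leaf (some e) => {e}
  | node B C => graph B ∪ graph C

/-- `Sub D A` means `D ⪯ A`: `D = ⟨⟩`, or `D = A`, or `D` is a sub-join-tree of a
child of `A`. -/
inductive Sub : JoinTree V → JoinTree V → Prop
  | empty (A : JoinTree V) : Sub (leaf none) A
  | refl (A : JoinTree V) : Sub A A
  | left {D B C : JoinTree V} : Sub D B → Sub D (node B C)
  | right {D B C : JoinTree V} : Sub D C → Sub D (node B C)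

/-- `SubP D A` means `D ≺ A`, i.e. `D ⪯ A` and `D ≠ A`. -/
def SubP (D A : JoinTree V) : Prop := Sub D A ∧ D ≠ A

/-- A join-tree is atomic if it is a single (labeled or unlabeled) leaf. -/
def Atomic (A : JoinTree V) : Prop := ∃ l, A = leaf l

/-- Replace every leaf label not belonging to `E'` by `⊥`. -/
def prune : JoinTree V → Finset (Sym2 V) → JoinTree V
  | leaf none, _ => leaf none
  | leaf (some e), E' => if e ∈ E' then leaf (some e) else leaf none
  | node B C, E' => node (prune B E') (prune C E')

/-- `A ⊖ S`: delete all leaf labels except those belonging to `Gr(A) ⊖ S`. -/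
def elimT (A : JoinTree V) (S : Set V) : JoinTree V := prune A (Paper.elimS A.graph S)

/-- `A` is a join-tree over the graph with edge set `E` (all labels come from `E`). -/
def Over (E : Set (Sym2 V)) (A : JoinTree V) : Prop := (A.graph : Set (Sym2 V)) ⊆ E

lemma graph_mono_of_sub {D A : JoinTree V} (h : Sub D A) : D.graph ⊆ A.graph := by
  induction h with
  | empty A => intro e he; simp [graph] at he
  | refl A => exact Finset.Subset.refl _
  | left _ ih => exact ih.trans Finset.subset_union_left
  | right _ ih => exact ih.trans Finset.subset_union_right

end JoinTree

open JoinTree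

/-- The coordinate set of the relation space `[n]^{F|S}`, namely `V(F) ∖ S`. -/
def coords (F : Finset (Sym2 V)) (S : Set V) : Set V := vset F \ S

lemma coords_mono {F F' : Finset (Sym2 V)} (h : F ⊆ F') (S : Set V) :
    coords F S ⊆ coords F' S := fun v hv => ⟨vset_mono h hv.1, hv.2⟩

lemma coords_anti (F : Finset (Sym2 V)) {S T : Set V} (hST : S ⊆ T) :
    coords F T ⊆ coords F S := fun v hv => ⟨hv.1, fun h => hv.2 (hST h)⟩

/-- Tuples `[n]^U`. -/
def Tup (n : ℕ) (U : Set V) : Type _ := U → Fin n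

/-- The density `μ(𝒜) = |𝒜| / n^{|U|}` of a relation `𝒜 ⊆ [n]^U`. -/
def mu (n : ℕ) {U : Set V} (R : Set (Tup n U)) : ℝ :=
  (R.ncard : ℝ) / (n : ℝ) ^ U.ncard

/-- Projection of a tuple to a subset of the coordinates. -/
def projMap (n : ℕ) {U U' : Set V} (h : U' ⊆ U) (x : Tup n U) : Tup n U' :=
  fun v => x ⟨v.1, h v.2⟩

/-- Projection of a relation to a subset of the coordinates. -/
def projSet (n : ℕ) {U U' : Set V} (h : U' ⊆ U) (R : Set (Tup n U)) : Set (Tup n U') :=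
  projMap n h '' R

/-- The restriction `𝒜 ↾ z ⊆ [n]^{V(F) ∖ T}` of a relation `𝒜 ⊆ [n]^{F|S}`,
for `T ⊇ S` and an assignment `z`: those `x` such that some `y ∈ 𝒜` agrees with
`x` on `V(F) ∖ T` and agrees with `z` on `V(F) ∩ T`. -/
def restrictRel (n : ℕ) (F : Finset (Sym2 V)) {S T : Set V} (hST : S ⊆ T)
    (z : V → Fin n) (R : Set (Tup n (coords F S))) : Set (Tup n (coords F T)) :=
  { x | ∃ y ∈ R, (∀ v : coords F T, y ⟨v.1, coords_anti F hST v.2⟩ = x v) ∧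
        (∀ v : coords F S, v.1 ∈ T → y v = z v.1) }

/-- `𝒜` is an `F|S`-pathset: every restriction has density at most
`(1/n)^{Δ_θ(F ⊖ T)}`. -/
def IsPathset (n : ℕ) (θ : Sym2 V → ℝ) (F : Finset (Sym2 V)) (S : Set V)
    (R : Set (Tup n (coords F S))) : Prop :=
  ∀ (T : Set V) (hST : S ⊆ T) (z : V → Fin n),
    mu n (restrictRel n F hST z R) ≤ ((1 : ℝ) / n) ^ (Delta θ (elimS F T))

/-- Pathset complexity `χ_{A|S}(𝒜)`. -/
def pchi (n : ℕ) (θ : Sym2 V → ℝ) (S : Set V) :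
    (A : JoinTree V) → Set (Tup n (coords A.graph S)) → ℕ
  | JoinTree.leaf l, R =>
      sInf { m | ∃ f : Fin m → Set (Tup n (coords (JoinTree.leaf l : JoinTree V).graph S)),
        (∀ i, IsPathset n θ (JoinTree.leaf l : JoinTree V).graph S (f i)) ∧ R ⊆ ⋃ i, f i }
  | JoinTree.node B C, R =>
      sInf { t | ∃ (m : ℕ)
        (As : Fin m → Set (Tup n (coords (JoinTree.node B C).graph S)))
        (Bs : Fin m → Set (Tup n (coords B.graph S)))
        (Cs : Fin m → Set (Tup n (coords C.graph S))),
        (∀ i, IsPathset n θ (JoinTree.node B C).graph S (As i)) ∧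
        (∀ i, IsPathset n θ B.graph S (Bs i)) ∧
        (∀ i, IsPathset n θ C.graph S (Cs i)) ∧
        (∀ i, ∀ x ∈ As i,
          projMap n (coords_mono
            (JoinTree.graph_mono_of_sub (JoinTree.Sub.left (JoinTree.Sub.refl B))) S) x ∈ Bs i ∧
          projMap n (coords_mono
            (JoinTree.graph_mono_of_sub (JoinTree.Sub.right (JoinTree.Sub.refl C))) S) x ∈ Cs i) ∧
        (R ⊆ ⋃ i, As i) ∧
        t = ∑ i, max (pchi n θ S B (Bs i)) (pchi n θ S C (Cs i)) }

lemma finite_vset (F : Finset (Sym2 V)) : (vset F).Finite := by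
  have h : vset F = ⋃ e ∈ F, {v | v ∈ e} := by
    ext v
    simp [vset]
  rw [h]
  refine F.finite_toSet.biUnion fun e _ => ?_
  induction e using Sym2.ind with
  | _ a b => exact (Set.toFinite {a, b}).subset fun v hv => by simpa using hv

lemma finite_coords (F : Finset (Sym2 V)) (S : Set V) : (coords F S).Finite :=
  (finite_vset F).subset Set.sdiff_subset

lemma finite_rel (n : ℕ) {F : Finset (Sym2 V)} {S : Set V} (R : Set (Tup n (coords F S))) :
    R.Finite := by
  have := (finite_coords F S).to_subtype
  have : Finite (Tup n (coords F S)) := inferInstanceAs (Finite (coords F S → Fin n))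
  exact R.toFinite

lemma vset_elimS_subset (F : Finset (Sym2 V)) (T : Set V) :
    vset (elimS F T) ⊆ coords F T := by
  rintro v ⟨e, he, hv⟩
  rw [elimS, Finset.mem_filter] at he
  exact ⟨⟨e, he.1, hv⟩, fun hT => he.2 v hv v hT (SimpleGraph.Reachable.refl v)⟩

lemma Delta_elimS_le {θ : Sym2 V → ℝ} {F : Finset (Sym2 V)} (hF : ∀ e ∈ F, 0 ≤ θ e)
    (T : Set V) : Delta θ (elimS F T) ≤ ((coords F T).ncard : ℝ) := by
  have h1 : ((vset (elimS F T)).ncard : ℝ) ≤ ((coords F T).ncard : ℝ) :=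
    Nat.cast_le.mpr (Set.ncard_le_ncard (vset_elimS_subset F T) (finite_coords F T))
  have h2 : 0 ≤ ∑ e ∈ elimS F T, θ e :=
    Finset.sum_nonneg fun e he => hF e (Finset.filter_subset _ _ he)
  rw [Delta]
  linarith

lemma IsPathset.singleton {n : ℕ} (hn : 0 < n) {θ : Sym2 V → ℝ} {F : Finset (Sym2 V)}
    (hF : ∀ e ∈ F, 0 ≤ θ e) {S : Set V} (x : Tup n (coords F S)) :
    IsPathset n θ F S {x} := by
  intro T hST z
  have hn' : (0 : ℝ) < n := Nat.cast_pos.mpr hn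
  have hcard : ((restrictRel n F hST z {x}).ncard : ℝ) ≤ 1 := by
    have : (restrictRel n F hST z {x}).ncard ≤ 1 := by
      rw [Set.ncard_le_one (finite_rel n _)]
      rintro a ⟨y, hy, ha, -⟩ b ⟨y', hy', hb, -⟩
      rw [Set.mem_singleton_iff] at hy hy'
      subst hy hy'
      funext v
      rw [← ha v, ← hb v]
    exact_mod_cast this
  calc mu n (restrictRel n F hST z {x})
      ≤ 1 / (n : ℝ) ^ (coords F T).ncard := by
        rw [mu]
        gcongr
    _ = (1 / (n : ℝ)) ^ ((coords F T).ncard : ℝ) := by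
        rw [Real.rpow_natCast, one_div_pow]
    _ ≤ (1 / (n : ℝ)) ^ Delta θ (elimS F T) := by
        refine Real.rpow_le_rpow_of_exponent_ge (by positivity) ?_ (Delta_elimS_le hF T)
        rw [div_le_one hn']
        exact_mod_cast hn

/-- A family of `m` triples of pathsets witnessing an upper bound on the pathset complexity of
`R` with respect to `⟨B, C⟩`. -/
structure NodeCover (n : ℕ) (θ : Sym2 V → ℝ) (S : Set V) (B C : JoinTree V)
    (R : Set (Tup n (coords (node B C).graph S))) (m : ℕ) where
  As : Fin m → Set (Tup n (coords (node B C).graph S))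
  Bs : Fin m → Set (Tup n (coords B.graph S))
  Cs : Fin m → Set (Tup n (coords C.graph S))
  pathset_As : ∀ i, IsPathset n θ (node B C).graph S (As i)
  pathset_Bs : ∀ i, IsPathset n θ B.graph S (Bs i)
  pathset_Cs : ∀ i, IsPathset n θ C.graph S (Cs i)
  subset_join : ∀ i, ∀ x ∈ As i,
    projMap n (coords_mono (graph_mono_of_sub (Sub.left (Sub.refl B))) S) x ∈ Bs i ∧
    projMap n (coords_mono (graph_mono_of_sub (Sub.right (Sub.refl C))) S) x ∈ Cs i
  subset_iUnion : R ⊆ ⋃ i, As i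

namespace NodeCover

variable {n : ℕ} {θ : Sym2 V → ℝ} {S : Set V} {B C : JoinTree V}
  {R R' : Set (Tup n (coords (node B C).graph S))} {m m' : ℕ}

/-- The total cost of a cover. -/
def cost (K : NodeCover n θ S B C R m) : ℕ :=
  ∑ i, max (pchi n θ S B (K.Bs i)) (pchi n θ S C (K.Cs i))

lemma pchi_le_cost (K : NodeCover n θ S B C R m) : pchi n θ S (node B C) R ≤ K.cost := by
  rw [pchi]
  exact Nat.sInf_le ⟨m, K.As, K.Bs, K.Cs, K.pathset_As, K.pathset_Bs, K.pathset_Cs,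
    K.subset_join, K.subset_iUnion, rfl⟩

/-- A cover of `R` also covers every subset of `R`. -/
def mono (K : NodeCover n θ S B C R m) (h : R' ⊆ R) : NodeCover n θ S B C R' m :=
  { K with subset_iUnion := h.trans K.subset_iUnion }

/-- The concatenation of two covers covers the union. -/
def append (K : NodeCover n θ S B C R m) (K' : NodeCover n θ S B C R' m') :
    NodeCover n θ S B C (R ∪ R') (m + m') where
  As := Fin.append K.As K'.As
  Bs := Fin.append K.Bs K'.Bs
  Cs := Fin.append K.Cs K'.Cs
  pathset_As i := by
    induction i using Fin.addCases <;> simp [K.pathset_As, K'.pathset_As]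
  pathset_Bs i := by
    induction i using Fin.addCases <;> simp [K.pathset_Bs, K'.pathset_Bs]
  pathset_Cs i := by
    induction i using Fin.addCases <;> simp [K.pathset_Cs, K'.pathset_Cs]
  subset_join i := by
    induction i using Fin.addCases with
    | left i => simpa using K.subset_join i
    | right i => simpa using K'.subset_join i
  subset_iUnion := by
    rintro x (hx | hx)
    · obtain ⟨i, hi⟩ := Set.mem_iUnion.mp (K.subset_iUnion hx)
      exact Set.mem_iUnion.mpr ⟨Fin.castAdd m' i, by simpa using hi⟩
    · obtain ⟨i, hi⟩ := Set.mem_iUnion.mp (K'.subset_iUnion hx)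
      exact Set.mem_iUnion.mpr ⟨Fin.natAdd m i, by simpa using hi⟩

lemma cost_append (K : NodeCover n θ S B C R m) (K' : NodeCover n θ S B C R' m') :
    (K.append K').cost = K.cost + K'.cost := by
  simp [cost, append, Fin.sum_univ_add]

end NodeCover

lemma JoinTree.Over.left {Eg : Set (Sym2 V)} {B C : JoinTree V} (h : Over Eg (node B C)) :
    Over Eg B :=
  fun _ he => h (Finset.mem_union_left _ he)

lemma JoinTree.Over.right {Eg : Set (Sym2 V)} {B C : JoinTree V} (h : Over Eg (node B C)) :
    Over Eg C :=
  fun _ he => h (Finset.mem_union_right _ he)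

lemma IsThresholdWeighting.nonneg {Eg : Set (Sym2 V)} {θ : Sym2 V → ℝ}
    (hθ : IsThresholdWeighting Eg θ) {A : JoinTree V} (hA : Over Eg A) :
    ∀ e ∈ A.graph, 0 ≤ θ e :=
  fun e he => (hθ.1 e (hA he)).1

section Complexity

variable {Eg : Set (Sym2 V)} {θ : Sym2 V → ℝ} {n : ℕ} {S : Set V}

lemma exists_singleton_cover {F : Finset (Sym2 V)} (R : Set (Tup n (coords F S))) :
    ∃ (m : ℕ) (f : Fin m → Tup n (coords F S)), R ⊆ ⋃ i, {f i} := by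
  obtain ⟨m, f, hf⟩ := (finite_rel n R).fin_param
  refine ⟨m, f, fun x hx => ?_⟩
  rw [← hf.2] at hx
  obtain ⟨i, rfl⟩ := hx
  exact Set.mem_iUnion.mpr ⟨i, rfl⟩

lemma exists_nodeCover_cost_eq (hn : 0 < n) (hθ : IsThresholdWeighting Eg θ)
    {B C : JoinTree V} (hover : Over Eg (node B C))
    (R : Set (Tup n (coords (node B C).graph S))) :
    ∃ (m : ℕ) (K : NodeCover n θ S B C R m), K.cost = pchi n θ S (node B C) R := by
  have hne := Nat.sInf_mem (s := {t | ∃ (m : ℕ) (K : NodeCover n θ S B C R m), K.cost = t}) <| by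
    obtain ⟨m, f, hf⟩ := exists_singleton_cover R
    exact ⟨_, m,
      { As := fun i => {f i}
        Bs := fun i => {projMap n _ (f i)}
        Cs := fun i => {projMap n _ (f i)}
        pathset_As := fun i => .singleton hn (hθ.nonneg hover) _
        pathset_Bs := fun i => .singleton hn (hθ.nonneg hover.left) _
        pathset_Cs := fun i => .singleton hn (hθ.nonneg hover.right) _
        subset_join := by
          rintro i x rfl
          exact ⟨rfl, rfl⟩
        subset_iUnion := hf }, rfl⟩
  obtain ⟨m, K, hK⟩ := hne
  refine ⟨m, K, le_antisymm (hK.trans_le ?_) K.pchi_le_cost⟩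
  rw [pchi]
  refine le_csInf ⟨_, m, K.As, K.Bs, K.Cs, K.pathset_As, K.pathset_Bs, K.pathset_Cs,
    K.subset_join, K.subset_iUnion, rfl⟩ ?_
  rintro t ⟨m', As, Bs, Cs, hA, hB, hC, hj, hR, rfl⟩
  exact Nat.sInf_le ⟨m', ⟨As, Bs, Cs, hA, hB, hC, hj, hR⟩, rfl⟩

lemma pchi_leaf_le {l : Option (Sym2 V)} {R : Set (Tup n (coords (leaf l).graph S))} {m : ℕ}
    (f : Fin m → Set (Tup n (coords (leaf l).graph S)))
    (hf : ∀ i, IsPathset n θ (leaf l).graph S (f i)) (hR : R ⊆ ⋃ i, f i) :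
    pchi n θ S (leaf l) R ≤ m := by
  rw [pchi]
  exact Nat.sInf_le ⟨f, hf, hR⟩

lemma exists_leaf_cover (hn : 0 < n) (hθ : IsThresholdWeighting Eg θ)
    {l : Option (Sym2 V)} (hover : Over Eg (leaf l))
    (R : Set (Tup n (coords (leaf l).graph S))) :
    ∃ f : Fin (pchi n θ S (leaf l) R) → Set (Tup n (coords (leaf l).graph S)),
      (∀ i, IsPathset n θ (leaf l).graph S (f i)) ∧ R ⊆ ⋃ i, f i := by
  have h := Nat.sInf_mem (s := { m | ∃ f : Fin m → Set (Tup n (coords (leaf l).graph S)),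
      (∀ i, IsPathset n θ (leaf l).graph S (f i)) ∧ R ⊆ ⋃ i, f i }) <| by
    obtain ⟨m, f, hf⟩ := exists_singleton_cover R
    exact ⟨m, fun i => {f i}, fun i => .singleton hn (hθ.nonneg hover) _, hf⟩
  rw [pchi]
  exact h

lemma pchi_mono (hn : 0 < n) (hθ : IsThresholdWeighting Eg θ) {A : JoinTree V}
    (hover : Over Eg A) {R R' : Set (Tup n (coords A.graph S))} (h : R ⊆ R') :
    pchi n θ S A R ≤ pchi n θ S A R' := by
  cases A with
  | leaf l =>
    obtain ⟨f, hf, hR⟩ := exists_leaf_cover hn hθ hover R'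
    exact pchi_leaf_le f hf (h.trans hR)
  | node B C =>
    obtain ⟨m, K, hK⟩ := exists_nodeCover_cost_eq hn hθ hover R'
    exact (K.mono h).pchi_le_cost.trans hK.le

lemma pchi_empty (A : JoinTree V) : pchi n θ S A ∅ = 0 := by
  refine Nat.le_zero.mp ?_
  cases A with
  | leaf l => exact pchi_leaf_le (m := 0) Fin.elim0 (fun i => i.elim0) (Set.empty_subset _)
  | node B C =>
    let K : NodeCover n θ S B C ∅ 0 :=
      ⟨Fin.elim0, Fin.elim0, Fin.elim0, fun i => i.elim0, fun i => i.elim0, fun i => i.elim0,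
        fun i => i.elim0, Set.empty_subset _⟩
    exact K.pchi_le_cost

lemma pchi_union_le (hn : 0 < n) (hθ : IsThresholdWeighting Eg θ) {A : JoinTree V}
    (hover : Over Eg A) (R R' : Set (Tup n (coords A.graph S))) :
    pchi n θ S A (R ∪ R') ≤ pchi n θ S A R + pchi n θ S A R' := by
  cases A with
  | leaf l =>
    obtain ⟨f, hf, hR⟩ := exists_leaf_cover hn hθ hover R
    obtain ⟨f', hf', hR'⟩ := exists_leaf_cover hn hθ hover R'
    refine pchi_leaf_le (Fin.append f f') (fun i => ?_) ?_
    · induction i using Fin.addCases <;> simp [hf, hf']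
    · rintro x (hx | hx)
      · obtain ⟨i, hi⟩ := Set.mem_iUnion.mp (hR hx)
        exact Set.mem_iUnion.mpr ⟨Fin.castAdd _ i, by simpa using hi⟩
      · obtain ⟨i, hi⟩ := Set.mem_iUnion.mp (hR' hx)
        exact Set.mem_iUnion.mpr ⟨Fin.natAdd _ i, by simpa using hi⟩
  | node B C =>
    obtain ⟨m, K, hK⟩ := exists_nodeCover_cost_eq hn hθ hover R
    obtain ⟨m', K', hK'⟩ := exists_nodeCover_cost_eq hn hθ hover R'
    rw [← hK, ← hK', ← K.cost_append K']
    exact (K.append K').pchi_le_cost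

lemma pchi_iUnion_le (hn : 0 < n) (hθ : IsThresholdWeighting Eg θ) {A : JoinTree V}
    (hover : Over Eg A) {ι : Type*} [Fintype ι] (f : ι → Set (Tup n (coords A.graph S))) :
    pchi n θ S A (⋃ i, f i) ≤ ∑ i, pchi n θ S A (f i) := by
  have key : ∀ s : Finset ι, pchi n θ S A (⋃ i ∈ s, f i) ≤ ∑ i ∈ s, pchi n θ S A (f i) := by
    intro s
    induction s using Finset.induction_on with
    | empty => simp [pchi_empty]
    | insert a s ha ih =>
      rw [Finset.set_biUnion_insert, Finset.sum_insert ha]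
      exact (pchi_union_le hn hθ hover _ _).trans (by gcongr)
  simpa using key Finset.univ

lemma pchi_pos (hn : 0 < n) (hθ : IsThresholdWeighting Eg θ) {A : JoinTree V}
    (hover : Over Eg A) {R : Set (Tup n (coords A.graph S))} (hR : R.Nonempty) :
    0 < pchi n θ S A R := by
  induction A with
  | leaf l =>
    obtain ⟨x, hx⟩ := hR
    obtain ⟨f, -, hf⟩ := exists_leaf_cover hn hθ hover R
    obtain ⟨i, -⟩ := Set.mem_iUnion.mp (hf hx)
    exact i.pos
  | node B C ihB _ =>
    obtain ⟨x, hx⟩ := hR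
    obtain ⟨m, K, hK⟩ := exists_nodeCover_cost_eq hn hθ hover R
    obtain ⟨i, hi⟩ := Set.mem_iUnion.mp (K.subset_iUnion hx)
    rw [← hK]
    refine Finset.sum_pos' (fun _ _ => Nat.zero_le _) ⟨i, Finset.mem_univ i, ?_⟩
    exact lt_max_of_lt_left (ihB hover.left ⟨_, (K.subset_join i x hi).1⟩)

lemma projSet_self {U : Set V} (h : U ⊆ U) (R : Set (Tup n U)) : projSet n h R = R :=
  Set.image_id R

lemma projSet_projSet {U U' U'' : Set V} (h : U' ⊆ U) (h' : U'' ⊆ U') (R : Set (Tup n U)) :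
    projSet n h' (projSet n h R) = projSet n (h'.trans h) R :=
  Set.image_image _ _ _

lemma pchi_leaf_none_projSet_le (hn : 0 < n) (hθ : IsThresholdWeighting Eg θ) {A : JoinTree V}
    (hover : Over Eg A) (R : Set (Tup n (coords A.graph S))) :
    pchi n θ S (leaf none)
      (projSet n (coords_mono (graph_mono_of_sub (Sub.empty A)) S) R) ≤ pchi n θ S A R := by
  obtain rfl | ⟨x, hx⟩ := R.eq_empty_or_nonempty
  · simp [projSet, pchi_empty]
  · refine le_trans ?_ (pchi_pos hn hθ hover ⟨x, hx⟩)
    refine pchi_leaf_le (m := 1)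
      (fun _ => {projMap n (coords_mono (graph_mono_of_sub (Sub.empty A)) S) x})
      (fun _ => .singleton hn (by simp [graph]) _) ?_
    intro y _
    refine Set.mem_iUnion.mpr ⟨0, ?_⟩
    funext v
    obtain ⟨e, he, -⟩ := v.2.1
    simp [graph] at he

lemma pchi_projSet_left_le (hn : 0 < n) (hθ : IsThresholdWeighting Eg θ) {B C : JoinTree V}
    (hover : Over Eg (node B C)) (R : Set (Tup n (coords (node B C).graph S))) :
    pchi n θ S B (projSet n (coords_mono (graph_mono_of_sub (Sub.left (Sub.refl B))) S) R)
      ≤ pchi n θ S (node B C) R := by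
  obtain ⟨m, K, hK⟩ := exists_nodeCover_cost_eq hn hθ hover R
  rw [← hK]
  calc _ ≤ pchi n θ S B (⋃ i, K.Bs i) := by
        refine pchi_mono hn hθ hover.left ?_
        rintro _ ⟨x, hx, rfl⟩
        obtain ⟨i, hi⟩ := Set.mem_iUnion.mp (K.subset_iUnion hx)
        exact Set.mem_iUnion.mpr ⟨i, (K.subset_join i x hi).1⟩
    _ ≤ ∑ i, pchi n θ S B (K.Bs i) := pchi_iUnion_le hn hθ hover.left _
    _ ≤ K.cost := Finset.sum_le_sum fun i _ => le_max_left _ _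

lemma pchi_projSet_right_le (hn : 0 < n) (hθ : IsThresholdWeighting Eg θ) {B C : JoinTree V}
    (hover : Over Eg (node B C)) (R : Set (Tup n (coords (node B C).graph S))) :
    pchi n θ S C (projSet n (coords_mono (graph_mono_of_sub (Sub.right (Sub.refl C))) S) R)
      ≤ pchi n θ S (node B C) R := by
  obtain ⟨m, K, hK⟩ := exists_nodeCover_cost_eq hn hθ hover R
  rw [← hK]
  calc _ ≤ pchi n θ S C (⋃ i, K.Cs i) := by
        refine pchi_mono hn hθ hover.right ?_
        rintro _ ⟨x, hx, rfl⟩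
        obtain ⟨i, hi⟩ := Set.mem_iUnion.mp (K.subset_iUnion hx)
        exact Set.mem_iUnion.mpr ⟨i, (K.subset_join i x hi).2⟩
    _ ≤ ∑ i, pchi n θ S C (K.Cs i) := pchi_iUnion_le hn hθ hover.right _
    _ ≤ K.cost := Finset.sum_le_sum fun i _ => le_max_right _ _

end Complexity

/-- **Projection Lemma.** For every relation `𝒜 ⊆ [n]^{A|S}` and
every sub-join-tree `B ⪯ A`, `χ_{B|S}(proj_{B|S}(𝒜)) ≤ χ_{A|S}(𝒜)`. -/
theorem stmt10 {V : Type*} (Eg : Set (Sym2 V)) (θ : Sym2 V → ℝ)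
    (hθ : IsThresholdWeighting Eg θ) (n : ℕ) (hn : 0 < n)
    (A : JoinTree V) (hover : Over Eg A) (S : Set V)
    (R : Set (Tup n (coords A.graph S)))
    (B : JoinTree V) (hB : Sub B A) :
    pchi n θ S B (projSet n (coords_mono (graph_mono_of_sub hB) S) R)
      ≤ pchi n θ S A R := by
  induction hB with
  | empty A => exact pchi_leaf_none_projSet_le hn hθ hover R
  | refl A => exact (congrArg (pchi n θ S A) (projSet_self _ R)).le
  | @left D B C h ih =>
    refine le_trans ?_ ((ih hover.left _).trans
      (pchi_projSet_left_le hn hθ hover R))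
    rw [projSet_projSet]
  | @right D B C h ih =>
    refine le_trans ?_ ((ih hover.right _).trans
      (pchi_projSet_right_le hn hθ hover R))
    rw [projSet_projSet]

end Paper

end
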